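/- One has the identity ⟨du_8, du_8⟩* = 896 u_12 u_2 + (160/9) u_9 u_5 + 112 u_8 u_6 - 8960 u_8 u_2^3 - (448/3) u_6^2 u_2 + 20160 u_6 u_2^4 - (2576/3) u_5^2 u_2^2 - 130560 u_2^7 as polynomials in the six variables y. -/

import Mathlib

open MvPolynomial

noncomputable section

/-- `S6 = x₁ + ⋯ + x₆` inside the eight variables `x₁,…,x₈`. -/
def S6 : MvPolynomial (Fin 8) ℚ := X 0 + X 1 + X 2 + X 3 + X 4 + X 5

/-- The `E₆`-invariant polynomial `U_m`. -/
def U (m : ℕ) : MvPolynomial (Fin 8) ℚ :=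
  (∑ i ∈ Finset.univ.filter (fun i : Fin 8 => i.val < 6),
      ((C (1/2 : ℚ) * (X 6 - X 7) - X i + C (1/6 : ℚ) * S6) ^ m +
        (-(C (1/2 : ℚ) * (X 6 - X 7)) - X i + C (1/6 : ℚ) * S6) ^ m)) +
    ∑ p ∈ Finset.univ.filter (fun p : Fin 8 × Fin 8 => p.1.val < p.2.val ∧ p.2.val < 6),
      (X p.1 + X p.2 - C (1/3 : ℚ) * S6) ^ m

/-- Restriction to the subspace `S6 = 0`, `x₇ + x₈ = 0`:
substitute `x₆ = -(x₁+⋯+x₅)` and `x₈ = -x₇`, with the remaining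
variables `y = (x₁,…,x₅,x₇)`. -/
def subE6 : Fin 8 → MvPolynomial (Fin 6) ℚ :=
  ![X 0, X 1, X 2, X 3, X 4, -(X 0 + X 1 + X 2 + X 3 + X 4), X 5, -X 5]

/-- The basic invariants `u_m` in the six variables `y`, with `u₂ = U₂/12`. -/
def u (m : ℕ) : MvPolynomial (Fin 6) ℚ :=
  if m = 2 then C (1/12 : ℚ) * aeval subE6 (U 2) else aeval subE6 (U m)

/-- The symmetric matrix `G` determined by `u₂(y) = ∑ᵢⱼ Gᵢⱼ yᵢ yⱼ`. -/
def GE6 : Matrix (Fin 6) (Fin 6) ℚ := fun i j =>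
  if i = j then coeff (Finsupp.single i 2) (u 2)
  else (1/2) * coeff (Finsupp.single i 1 + Finsupp.single j 1) (u 2)

/-- The pairing `⟨dp, dq⟩* = ∑ᵢⱼ (∂p/∂yᵢ) (G⁻¹)ᵢⱼ (∂q/∂yⱼ)`. -/
def pairE6 (p q : MvPolynomial (Fin 6) ℚ) : MvPolynomial (Fin 6) ℚ :=
  ∑ i : Fin 6, ∑ j : Fin 6, C (GE6⁻¹ i j) * pderiv i p * pderiv j q


/-- Power sums of six elements. -/
def pS {R : Type*} [CommRing R] (x0 x1 x2 x3 x4 s : R) (k : ℕ) : R :=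
  x0 ^ k + x1 ^ k + x2 ^ k + x3 ^ k + x4 ^ k + s ^ k

/-- The power sums of the 27 weights. -/
def W {R : Type*} [CommRing R] (x0 x1 x2 x3 x4 s t : R) (m : ℕ) : R :=
  ((t - x0) ^ m + (-t - x0) ^ m) + ((t - x1) ^ m + (-t - x1) ^ m) +
  ((t - x2) ^ m + (-t - x2) ^ m) + ((t - x3) ^ m + (-t - x3) ^ m) +
  ((t - x4) ^ m + (-t - x4) ^ m) + ((t - s) ^ m + (-t - s) ^ m) +
  ((x0 + x1) ^ m + (x0 + x2) ^ m + (x0 + x3) ^ m + (x0 + x4) ^ m + (x0 + s) ^ m +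
   (x1 + x2) ^ m + (x1 + x3) ^ m + (x1 + x4) ^ m + (x1 + s) ^ m +
   (x2 + x3) ^ m + (x2 + x4) ^ m + (x2 + s) ^ m +
   (x3 + x4) ^ m + (x3 + s) ^ m + (x4 + s) ^ m)

theorem W_2 {R : Type*} [CommRing R] (x0 x1 x2 x3 x4 s t : R) (h : x0 + x1 + x2 + x3 + x4 + s = 0) :
    W x0 x1 x2 x3 x4 s t 2 = (6)*pS x0 x1 x2 x3 x4 s 2 + (12)*t^2 := by
  have h1 : pS x0 x1 x2 x3 x4 s 1 = 0 := by simpa [pS] using h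
  have h2 : W x0 x1 x2 x3 x4 s t 2 = (6)*pS x0 x1 x2 x3 x4 s 2 + (12)*t^2 + pS x0 x1 x2 x3 x4 s 1 * (pS x0 x1 x2 x3 x4 s 1) := by
    simp only [W, pS]; ring
  rw [h2, h1]; ring

theorem W_5 {R : Type*} [CommRing R] (x0 x1 x2 x3 x4 s t : R) (h : x0 + x1 + x2 + x3 + x4 + s = 0) :
    W x0 x1 x2 x3 x4 s t 5 = (-12)*pS x0 x1 x2 x3 x4 s 5 + (-20)*t^2*pS x0 x1 x2 x3 x4 s 3 + (10)*pS x0 x1 x2 x3 x4 s 2*pS x0 x1 x2 x3 x4 s 3 := by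
  have h1 : pS x0 x1 x2 x3 x4 s 1 = 0 := by simpa [pS] using h
  have h2 : W x0 x1 x2 x3 x4 s t 5 = (-12)*pS x0 x1 x2 x3 x4 s 5 + (-20)*t^2*pS x0 x1 x2 x3 x4 s 3 + (10)*pS x0 x1 x2 x3 x4 s 2*pS x0 x1 x2 x3 x4 s 3 + pS x0 x1 x2 x3 x4 s 1 * (5*pS x0 x1 x2 x3 x4 s 4 - 10*t^4) := by
    simp only [W, pS]; ring
  rw [h2, h1]; ring

theorem W_6 {R : Type*} [CommRing R] (x0 x1 x2 x3 x4 s t : R) (h : x0 + x1 + x2 + x3 + x4 + s = 0) :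
    W x0 x1 x2 x3 x4 s t 6 = (-24)*pS x0 x1 x2 x3 x4 s 6 + (30)*t^2*pS x0 x1 x2 x3 x4 s 4 + (30)*t^4*pS x0 x1 x2 x3 x4 s 2 + (12)*t^6 + (15)*pS x0 x1 x2 x3 x4 s 2*pS x0 x1 x2 x3 x4 s 4 + (10)*pS x0 x1 x2 x3 x4 s 3*pS x0 x1 x2 x3 x4 s 3 := by
  have h1 : pS x0 x1 x2 x3 x4 s 1 = 0 := by simpa [pS] using h
  have h2 : W x0 x1 x2 x3 x4 s t 6 = (-24)*pS x0 x1 x2 x3 x4 s 6 + (30)*t^2*pS x0 x1 x2 x3 x4 s 4 + (30)*t^4*pS x0 x1 x2 x3 x4 s 2 + (12)*t^6 + (15)*pS x0 x1 x2 x3 x4 s 2*pS x0 x1 x2 x3 x4 s 4 + (10)*pS x0 x1 x2 x3 x4 s 3*pS x0 x1 x2 x3 x4 s 3 + pS x0 x1 x2 x3 x4 s 1 * (6*pS x0 x1 x2 x3 x4 s 5) := by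
    simp only [W, pS]; ring
  rw [h2, h1]; ring

theorem W_8 {R : Type*} [CommRing R] (x0 x1 x2 x3 x4 s t : R) (h : x0 + x1 + x2 + x3 + x4 + s = 0) :
    W x0 x1 x2 x3 x4 s t 8 = (-120)*pS x0 x1 x2 x3 x4 s 8 + (56)*t^2*pS x0 x1 x2 x3 x4 s 6 + (140)*t^4*pS x0 x1 x2 x3 x4 s 4 + (56)*t^6*pS x0 x1 x2 x3 x4 s 2 + (12)*t^8 + (28)*pS x0 x1 x2 x3 x4 s 2*pS x0 x1 x2 x3 x4 s 6 + (56)*pS x0 x1 x2 x3 x4 s 3*pS x0 x1 x2 x3 x4 s 5 + (35)*pS x0 x1 x2 x3 x4 s 4*pS x0 x1 x2 x3 x4 s 4 := by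
  have h1 : pS x0 x1 x2 x3 x4 s 1 = 0 := by simpa [pS] using h
  have h2 : W x0 x1 x2 x3 x4 s t 8 = (-120)*pS x0 x1 x2 x3 x4 s 8 + (56)*t^2*pS x0 x1 x2 x3 x4 s 6 + (140)*t^4*pS x0 x1 x2 x3 x4 s 4 + (56)*t^6*pS x0 x1 x2 x3 x4 s 2 + (12)*t^8 + (28)*pS x0 x1 x2 x3 x4 s 2*pS x0 x1 x2 x3 x4 s 6 + (56)*pS x0 x1 x2 x3 x4 s 3*pS x0 x1 x2 x3 x4 s 5 + (35)*pS x0 x1 x2 x3 x4 s 4*pS x0 x1 x2 x3 x4 s 4 + pS x0 x1 x2 x3 x4 s 1 * (8*pS x0 x1 x2 x3 x4 s 7) := by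
    simp only [W, pS]; ring
  rw [h2, h1]; ring

theorem W_9 {R : Type*} [CommRing R] (x0 x1 x2 x3 x4 s t : R) (h : x0 + x1 + x2 + x3 + x4 + s = 0) :
    W x0 x1 x2 x3 x4 s t 9 = (-252)*pS x0 x1 x2 x3 x4 s 9 + (-72)*t^2*pS x0 x1 x2 x3 x4 s 7 + (-252)*t^4*pS x0 x1 x2 x3 x4 s 5 + (-168)*t^6*pS x0 x1 x2 x3 x4 s 3 + (36)*pS x0 x1 x2 x3 x4 s 2*pS x0 x1 x2 x3 x4 s 7 + (84)*pS x0 x1 x2 x3 x4 s 3*pS x0 x1 x2 x3 x4 s 6 + (126)*pS x0 x1 x2 x3 x4 s 4*pS x0 x1 x2 x3 x4 s 5 := by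
  have h1 : pS x0 x1 x2 x3 x4 s 1 = 0 := by simpa [pS] using h
  have h2 : W x0 x1 x2 x3 x4 s t 9 = (-252)*pS x0 x1 x2 x3 x4 s 9 + (-72)*t^2*pS x0 x1 x2 x3 x4 s 7 + (-252)*t^4*pS x0 x1 x2 x3 x4 s 5 + (-168)*t^6*pS x0 x1 x2 x3 x4 s 3 + (36)*pS x0 x1 x2 x3 x4 s 2*pS x0 x1 x2 x3 x4 s 7 + (84)*pS x0 x1 x2 x3 x4 s 3*pS x0 x1 x2 x3 x4 s 6 + (126)*pS x0 x1 x2 x3 x4 s 4*pS x0 x1 x2 x3 x4 s 5 + pS x0 x1 x2 x3 x4 s 1 * (9*pS x0 x1 x2 x3 x4 s 8 - 18*t^8) := by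
    simp only [W, pS]; ring
  rw [h2, h1]; ring

theorem W_12 {R : Type*} [CommRing R] (x0 x1 x2 x3 x4 s t : R) (h : x0 + x1 + x2 + x3 + x4 + s = 0) :
    W x0 x1 x2 x3 x4 s t 12 = (-2040)*pS x0 x1 x2 x3 x4 s 12 + (132)*t^2*pS x0 x1 x2 x3 x4 s 10 + (990)*t^4*pS x0 x1 x2 x3 x4 s 8 + (1848)*t^6*pS x0 x1 x2 x3 x4 s 6 + (990)*t^8*pS x0 x1 x2 x3 x4 s 4 + (132)*t^10*pS x0 x1 x2 x3 x4 s 2 + (12)*t^12 + (66)*pS x0 x1 x2 x3 x4 s 2*pS x0 x1 x2 x3 x4 s 10 + (220)*pS x0 x1 x2 x3 x4 s 3*pS x0 x1 x2 x3 x4 s 9 + (495)*pS x0 x1 x2 x3 x4 s 4*pS x0 x1 x2 x3 x4 s 8 + (792)*pS x0 x1 x2 x3 x4 s 5*pS x0 x1 x2 x3 x4 s 7 + (462)*pS x0 x1 x2 x3 x4 s 6*pS x0 x1 x2 x3 x4 s 6 := by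
  have h1 : pS x0 x1 x2 x3 x4 s 1 = 0 := by simpa [pS] using h
  have h2 : W x0 x1 x2 x3 x4 s t 12 = (-2040)*pS x0 x1 x2 x3 x4 s 12 + (132)*t^2*pS x0 x1 x2 x3 x4 s 10 + (990)*t^4*pS x0 x1 x2 x3 x4 s 8 + (1848)*t^6*pS x0 x1 x2 x3 x4 s 6 + (990)*t^8*pS x0 x1 x2 x3 x4 s 4 + (132)*t^10*pS x0 x1 x2 x3 x4 s 2 + (12)*t^12 + (66)*pS x0 x1 x2 x3 x4 s 2*pS x0 x1 x2 x3 x4 s 10 + (220)*pS x0 x1 x2 x3 x4 s 3*pS x0 x1 x2 x3 x4 s 9 + (495)*pS x0 x1 x2 x3 x4 s 4*pS x0 x1 x2 x3 x4 s 8 + (792)*pS x0 x1 x2 x3 x4 s 5*pS x0 x1 x2 x3 x4 s 7 + (462)*pS x0 x1 x2 x3 x4 s 6*pS x0 x1 x2 x3 x4 s 6 + pS x0 x1 x2 x3 x4 s 1 * (12*pS x0 x1 x2 x3 x4 s 11) := by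
    simp only [W, pS]; ring
  rw [h2, h1]; ring

theorem newton (x0 x1 x2 x3 x4 s : ℚ) (h : x0 + x1 + x2 + x3 + x4 + s = 0) :
    ∃ a b c d f : ℚ,
      pS x0 x1 x2 x3 x4 s 2 = (-2)*a ∧
      pS x0 x1 x2 x3 x4 s 3 = (3)*b ∧
      pS x0 x1 x2 x3 x4 s 4 = (2)*a^2 + (-4)*c ∧
      pS x0 x1 x2 x3 x4 s 5 = (-5)*a*b + (5)*d ∧
      pS x0 x1 x2 x3 x4 s 6 = (-2)*a^3 + (6)*a*c + (3)*b^2 + (-6)*f ∧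
      pS x0 x1 x2 x3 x4 s 7 = (7)*a^2*b + (-7)*a*d + (-7)*b*c ∧
      pS x0 x1 x2 x3 x4 s 8 = (2)*a^4 + (-8)*a^2*c + (-8)*a*b^2 + (8)*a*f + (8)*b*d + (4)*c^2 ∧
      pS x0 x1 x2 x3 x4 s 9 = (-9)*a^3*b + (9)*a^2*d + (18)*a*b*c + (3)*b^3 + (-9)*b*f + (-9)*c*d ∧
      pS x0 x1 x2 x3 x4 s 10 = (-2)*a^5 + (10)*a^3*c + (15)*a^2*b^2 + (-10)*a^2*f + (-20)*a*b*d + (-10)*a*c^2 + (-10)*b^2*c + (10)*c*f + (5)*d^2 ∧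
      pS x0 x1 x2 x3 x4 s 11 = (11)*a^4*b + (-11)*a^3*d + (-33)*a^2*b*c + (-11)*a*b^3 + (22)*a*b*f + (22)*a*c*d + (11)*b^2*d + (11)*b*c^2 + (-11)*d*f ∧
      pS x0 x1 x2 x3 x4 s 12 = (2)*a^6 + (-12)*a^4*c + (-24)*a^3*b^2 + (12)*a^3*f + (36)*a^2*b*d + (18)*a^2*c^2 + (36)*a*b^2*c + (-24)*a*c*f + (-12)*a*d^2 + (3)*b^4 + (-12)*b^2*f + (-24)*b*c*d + (-4)*c^3 + (6)*f^2 ∧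
      pS x0 x1 x2 x3 x4 s 13 = (-13)*a^5*b + (13)*a^4*d + (52)*a^3*b*c + (26)*a^2*b^3 + (-39)*a^2*b*f + (-39)*a^2*c*d + (-39)*a*b^2*d + (-39)*a*b*c^2 + (26)*a*d*f + (-13)*b^3*c + (26)*b*c*f + (13)*b*d^2 + (13)*c^2*d ∧
      pS x0 x1 x2 x3 x4 s 14 = (-2)*a^7 + (14)*a^5*c + (35)*a^4*b^2 + (-14)*a^4*f + (-56)*a^3*b*d + (-28)*a^3*c^2 + (-84)*a^2*b^2*c + (42)*a^2*c*f + (21)*a^2*d^2 + (-14)*a*b^4 + (42)*a*b^2*f + (84)*a*b*c*d + (14)*a*c^3 + (-14)*a*f^2 + (14)*b^3*d + (21)*b^2*c^2 + (-28)*b*d*f + (-14)*c^2*f + (-14)*c*d^2 := by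
  let a : ℚ := x0*x1 + x0*x2 + x0*x3 + x0*x4 + x0*s + x1*x2 + x1*x3 + x1*x4 + x1*s + x2*x3 + x2*x4 + x2*s + x3*x4 + x3*s + x4*s
  let b : ℚ := x0*x1*x2 + x0*x1*x3 + x0*x1*x4 + x0*x1*s + x0*x2*x3 + x0*x2*x4 + x0*x2*s + x0*x3*x4 + x0*x3*s + x0*x4*s + x1*x2*x3 + x1*x2*x4 + x1*x2*s + x1*x3*x4 + x1*x3*s + x1*x4*s + x2*x3*x4 + x2*x3*s + x2*x4*s + x3*x4*s
  let c : ℚ := x0*x1*x2*x3 + x0*x1*x2*x4 + x0*x1*x2*s + x0*x1*x3*x4 + x0*x1*x3*s + x0*x1*x4*s + x0*x2*x3*x4 + x0*x2*x3*s + x0*x2*x4*s + x0*x3*x4*s + x1*x2*x3*x4 + x1*x2*x3*s + x1*x2*x4*s + x1*x3*x4*s + x2*x3*x4*s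
  let d : ℚ := x0*x1*x2*x3*x4 + x0*x1*x2*x3*s + x0*x1*x2*x4*s + x0*x1*x3*x4*s + x0*x2*x3*x4*s + x1*x2*x3*x4*s
  let f : ℚ := x0*x1*x2*x3*x4*s
  have hs : s = -(x0 + x1 + x2 + x3 + x4) := by linarith
  have p2 : pS x0 x1 x2 x3 x4 s 2 = (-2)*a := by
    simp only [pS, a, b, c, d, f]; rw [hs]; ring
  have p3 : pS x0 x1 x2 x3 x4 s 3 = (3)*b := by
    simp only [pS, a, b, c, d, f]; rw [hs]; ring
  have p4 : pS x0 x1 x2 x3 x4 s 4 = (2)*a^2 + (-4)*c := by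
    simp only [pS, a, b, c, d, f]; rw [hs]; ring
  have p5 : pS x0 x1 x2 x3 x4 s 5 = (-5)*a*b + (5)*d := by
    simp only [pS, a, b, c, d, f]; rw [hs]; ring
  have rx0 : x0^6 = -a*x0^4 + b*x0^3 - c*x0^2 + d*x0 - f := by
    simp only [a, b, c, d, f]; linear_combination x0^5*h
  have rx1 : x1^6 = -a*x1^4 + b*x1^3 - c*x1^2 + d*x1 - f := by
    simp only [a, b, c, d, f]; linear_combination x1^5*h
  have rx2 : x2^6 = -a*x2^4 + b*x2^3 - c*x2^2 + d*x2 - f := by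
    simp only [a, b, c, d, f]; linear_combination x2^5*h
  have rx3 : x3^6 = -a*x3^4 + b*x3^3 - c*x3^2 + d*x3 - f := by
    simp only [a, b, c, d, f]; linear_combination x3^5*h
  have rx4 : x4^6 = -a*x4^4 + b*x4^3 - c*x4^2 + d*x4 - f := by
    simp only [a, b, c, d, f]; linear_combination x4^5*h
  have rs : s^6 = -a*s^4 + b*s^3 - c*s^2 + d*s - f := by
    simp only [a, b, c, d, f]; linear_combination s^5*h
  have p0 : pS x0 x1 x2 x3 x4 s 0 = 6 := by simp only [pS]; norm_num
  have p1 : pS x0 x1 x2 x3 x4 s 1 = 0 := by simpa [pS] using h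
  have hrec (k : ℕ) : pS x0 x1 x2 x3 x4 s (k+6) = -a * pS x0 x1 x2 x3 x4 s (k+4) + b * pS x0 x1 x2 x3 x4 s (k+3)
      - c * pS x0 x1 x2 x3 x4 s (k+2) + d * pS x0 x1 x2 x3 x4 s (k+1) - f * pS x0 x1 x2 x3 x4 s k := by
    simp only [pS]
    linear_combination x0^k*rx0 + x1^k*rx1 + x2^k*rx2 + x3^k*rx3 + x4^k*rx4 + s^k*rs
  clear_value a b c d f
  have p6 : pS x0 x1 x2 x3 x4 s 6 = (-2)*a^3 + (6)*a*c + (3)*b^2 + (-6)*f := by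
    have := hrec 0
    norm_num only at this
    rw [this, p4, p3, p2, p1, p0]; ring
  have p7 : pS x0 x1 x2 x3 x4 s 7 = (7)*a^2*b + (-7)*a*d + (-7)*b*c := by
    have := hrec 1
    norm_num only at this
    rw [this, p5, p4, p3, p2, p1]; ring
  have p8 : pS x0 x1 x2 x3 x4 s 8 = (2)*a^4 + (-8)*a^2*c + (-8)*a*b^2 + (8)*a*f + (8)*b*d + (4)*c^2 := by
    have := hrec 2
    norm_num only at this
    rw [this, p6, p5, p4, p3, p2]; ring
  have p9 : pS x0 x1 x2 x3 x4 s 9 = (-9)*a^3*b + (9)*a^2*d + (18)*a*b*c + (3)*b^3 + (-9)*b*f + (-9)*c*d := by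
    have := hrec 3
    norm_num only at this
    rw [this, p7, p6, p5, p4, p3]; ring
  have p10 : pS x0 x1 x2 x3 x4 s 10 = (-2)*a^5 + (10)*a^3*c + (15)*a^2*b^2 + (-10)*a^2*f + (-20)*a*b*d + (-10)*a*c^2 + (-10)*b^2*c + (10)*c*f + (5)*d^2 := by
    have := hrec 4
    norm_num only at this
    rw [this, p8, p7, p6, p5, p4]; ring
  have p11 : pS x0 x1 x2 x3 x4 s 11 = (11)*a^4*b + (-11)*a^3*d + (-33)*a^2*b*c + (-11)*a*b^3 + (22)*a*b*f + (22)*a*c*d + (11)*b^2*d + (11)*b*c^2 + (-11)*d*f := by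
    have := hrec 5
    norm_num only at this
    rw [this, p9, p8, p7, p6, p5]; ring
  have p12 : pS x0 x1 x2 x3 x4 s 12 = (2)*a^6 + (-12)*a^4*c + (-24)*a^3*b^2 + (12)*a^3*f + (36)*a^2*b*d + (18)*a^2*c^2 + (36)*a*b^2*c + (-24)*a*c*f + (-12)*a*d^2 + (3)*b^4 + (-12)*b^2*f + (-24)*b*c*d + (-4)*c^3 + (6)*f^2 := by
    have := hrec 6
    norm_num only at this
    rw [this, p10, p9, p8, p7, p6]; ring
  have p13 : pS x0 x1 x2 x3 x4 s 13 = (-13)*a^5*b + (13)*a^4*d + (52)*a^3*b*c + (26)*a^2*b^3 + (-39)*a^2*b*f + (-39)*a^2*c*d + (-39)*a*b^2*d + (-39)*a*b*c^2 + (26)*a*d*f + (-13)*b^3*c + (26)*b*c*f + (13)*b*d^2 + (13)*c^2*d := by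
    have := hrec 7
    norm_num only at this
    rw [this, p11, p10, p9, p8, p7]; ring
  have p14 : pS x0 x1 x2 x3 x4 s 14 = (-2)*a^7 + (14)*a^5*c + (35)*a^4*b^2 + (-14)*a^4*f + (-56)*a^3*b*d + (-28)*a^3*c^2 + (-84)*a^2*b^2*c + (42)*a^2*c*f + (21)*a^2*d^2 + (-14)*a*b^4 + (42)*a*b^2*f + (84)*a*b*c*d + (14)*a*c^3 + (-14)*a*f^2 + (14)*b^3*d + (21)*b^2*c^2 + (-28)*b*d*f + (-14)*c^2*f + (-14)*c*d^2 := by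
    have := hrec 8
    norm_num only at this
    rw [this, p12, p11, p10, p9, p8]; ring
  exact ⟨a, b, c, d, f, p2, p3, p4, p5, p6, p7, p8, p9, p10, p11, p12, p13, p14⟩

/-- Formal gradient of `u₈` in a coordinate direction. -/
def gr {R : Type*} [CommRing R] (x0 x1 x2 x3 x4 s t z : R) : R :=
  -960*z^7 + (336*t^2 + 168*pS x0 x1 x2 x3 x4 s 2)*z^5 + 280*pS x0 x1 x2 x3 x4 s 3*z^4 + (560*t^4 + 280*pS x0 x1 x2 x3 x4 s 4)*z^3 + 168*pS x0 x1 x2 x3 x4 s 5*z^2 + (112*t^6 + 56*pS x0 x1 x2 x3 x4 s 6)*z^1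


theorem sum_lin (x0 x1 x2 x3 x4 s c8 c6 c5 c4 c3 c2 : ℚ) :
    (c8*x0^7 + c6*x0^5 + c5*x0^4 + c4*x0^3 + c3*x0^2 + c2*x0^1) + (c8*x1^7 + c6*x1^5 + c5*x1^4 + c4*x1^3 + c3*x1^2 + c2*x1^1) + (c8*x2^7 + c6*x2^5 + c5*x2^4 + c4*x2^3 + c3*x2^2 + c2*x2^1) + (c8*x3^7 + c6*x3^5 + c5*x3^4 + c4*x3^3 + c3*x3^2 + c2*x3^1) + (c8*x4^7 + c6*x4^5 + c5*x4^4 + c4*x4^3 + c3*x4^2 + c2*x4^1) + (c8*s^7 + c6*s^5 + c5*s^4 + c4*s^3 + c3*s^2 + c2*s^1) = c8*pS x0 x1 x2 x3 x4 s 7 + c6*pS x0 x1 x2 x3 x4 s 5 + c5*pS x0 x1 x2 x3 x4 s 4 + c4*pS x0 x1 x2 x3 x4 s 3 + c3*pS x0 x1 x2 x3 x4 s 2 + c2*pS x0 x1 x2 x3 x4 s 1 := by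
  simp only [pS]; ring

theorem sum_sq (x0 x1 x2 x3 x4 s c8 c6 c5 c4 c3 c2 : ℚ) :
    (c8*x0^7 + c6*x0^5 + c5*x0^4 + c4*x0^3 + c3*x0^2 + c2*x0^1)^2 + (c8*x1^7 + c6*x1^5 + c5*x1^4 + c4*x1^3 + c3*x1^2 + c2*x1^1)^2 + (c8*x2^7 + c6*x2^5 + c5*x2^4 + c4*x2^3 + c3*x2^2 + c2*x2^1)^2 + (c8*x3^7 + c6*x3^5 + c5*x3^4 + c4*x3^3 + c3*x3^2 + c2*x3^1)^2 + (c8*x4^7 + c6*x4^5 + c5*x4^4 + c4*x4^3 + c3*x4^2 + c2*x4^1)^2 + (c8*s^7 + c6*s^5 + c5*s^4 + c4*s^3 + c3*s^2 + c2*s^1)^2 = (c8*c8)*pS x0 x1 x2 x3 x4 s 14 + (2*c8*c6)*pS x0 x1 x2 x3 x4 s 12 + (2*c8*c5)*pS x0 x1 x2 x3 x4 s 11 + (2*c8*c4 + c6*c6)*pS x0 x1 x2 x3 x4 s 10 + (2*c8*c3 + 2*c6*c5)*pS x0 x1 x2 x3 x4 s 9 + (2*c8*c2 + 2*c6*c4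 + c5*c5)*pS x0 x1 x2 x3 x4 s 8 + (2*c6*c3 + 2*c5*c4)*pS x0 x1 x2 x3 x4 s 7 + (2*c6*c2 + 2*c5*c3 + c4*c4)*pS x0 x1 x2 x3 x4 s 6 + (2*c5*c2 + 2*c4*c3)*pS x0 x1 x2 x3 x4 s 5 + (2*c4*c2 + c3*c3)*pS x0 x1 x2 x3 x4 s 4 + (2*c3*c2)*pS x0 x1 x2 x3 x4 s 3 + (c2*c2)*pS x0 x1 x2 x3 x4 s 2 := by
  simp only [pS]; ring

theorem final_id (x0 x1 x2 x3 x4 s t : ℚ) (h : x0 + x1 + x2 + x3 + x4 + s = 0) :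
    (112*t*pS x0 x1 x2 x3 x4 s 6 + 560*t^3*pS x0 x1 x2 x3 x4 s 4 + 336*t^5*pS x0 x1 x2 x3 x4 s 2 + 96*t^7)^2 + 2*((gr x0 x1 x2 x3 x4 s t x0^2 + gr x0 x1 x2 x3 x4 s t x1^2 + gr x0 x1 x2 x3 x4 s t x2^2 + gr x0 x1 x2 x3 x4 s t x3^2 + gr x0 x1 x2 x3 x4 s t x4^2 + gr x0 x1 x2 x3 x4 s t s^2)
      - (gr x0 x1 x2 x3 x4 s t x0 + gr x0 x1 x2 x3 x4 s t x1 + gr x0 x1 x2 x3 x4 s t x2 + gr x0 x1 x2 x3 x4 s t x3 + gr x0 x1 x2 x3 x4 s t x4 + gr x0 x1 x2 x3 x4 s t s)^2/6) =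
    896 * W x0 x1 x2 x3 x4 s t 12 * (1/12 * W x0 x1 x2 x3 x4 s t 2) + 160/9 * W x0 x1 x2 x3 x4 s t 9 * W x0 x1 x2 x3 x4 s t 5
      + 112 * W x0 x1 x2 x3 x4 s t 8 * W x0 x1 x2 x3 x4 s t 6
      - 8960 * W x0 x1 x2 x3 x4 s t 8 * (1/12 * W x0 x1 x2 x3 x4 s t 2)^3 - 448/3 * W x0 x1 x2 x3 x4 s t 6 ^ 2 * (1/12 * W x0 x1 x2 x3 x4 s t 2)
      + 20160 * W x0 x1 x2 x3 x4 s t 6 * (1/12 * W x0 x1 x2 x3 x4 s t 2)^4 - 2576/3 * W x0 x1 x2 x3 x4 s t 5 ^ 2 * (1/12 * W x0 x1 x2 x3 x4 s t 2)^2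
      - 130560 * (1/12 * W x0 x1 x2 x3 x4 s t 2)^7 := by
  simp only [gr]
  rw [sum_lin, sum_sq, W_2 _ _ _ _ _ _ _ h, W_5 _ _ _ _ _ _ _ h, W_6 _ _ _ _ _ _ _ h, W_8 _ _ _ _ _ _ _ h,
    W_9 _ _ _ _ _ _ _ h, W_12 _ _ _ _ _ _ _ h]
  obtain ⟨a, b, c, d, f, p2, p3, p4, p5, p6, p7, p8, p9, p10, p11, p12, p13, p14⟩ := newton _ _ _ _ _ _ h
  have p1 : pS x0 x1 x2 x3 x4 s 1 = 0 := by simpa [pS] using h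
  rw [p1, p2, p3, p4, p5, p6, p7, p8, p9, p10, p11, p12, p14]
  ring

theorem aeval_U (m : ℕ) : aeval subE6 (U m) =
    W (X 0) (X 1) (X 2) (X 3) (X 4) (-(X 0 + X 1 + X 2 + X 3 + X 4)) (X 5 : MvPolynomial (Fin 6) ℚ) m := by
  have hS : aeval subE6 S6 = 0 := by
    simp [S6, subE6]
  have h6 : aeval subE6 (C (1/2 : ℚ) * (X 6 - X 7)) = (X 5 : MvPolynomial (Fin 6) ℚ) := by
    have h2 : (C (1/2 : ℚ) : MvPolynomial (Fin 6) ℚ) * 2 = 1 := by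
      rw [show (2 : MvPolynomial (Fin 6) ℚ) = C 2 from rfl, ← C_mul]; norm_num
    simp only [map_mul, map_sub, aeval_X, aeval_C, subE6, algebraMap_eq]
    simp only [Matrix.cons_val]
    linear_combination X 5 * h2
  unfold U
  simp only [map_add, map_sum, map_pow, map_sub, map_neg, map_mul _ (C _) S6, hS, h6, mul_zero, add_zero, sub_zero,
    aeval_X]
  rw [Finset.sum_filter, Finset.sum_filter, Fintype.sum_prod_type]
  simp only [Fin.sum_univ_eight]
  simp [subE6, W]
  ring

theorem u_two : u 2 = C (1/12 : ℚ) *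
    W (X 0) (X 1) (X 2) (X 3) (X 4) (-(X 0 + X 1 + X 2 + X 3 + X 4)) (X 5 : MvPolynomial (Fin 6) ℚ) 2 := by
  rw [u, if_pos rfl, aeval_U]

theorem u_ne (m : ℕ) (hm : m ≠ 2) : u m =
    W (X 0) (X 1) (X 2) (X 3) (X 4) (-(X 0 + X 1 + X 2 + X 3 + X 4)) (X 5 : MvPolynomial (Fin 6) ℚ) m := by
  rw [u, if_neg hm, aeval_U]

theorem eval_W (y : Fin 6 → ℚ) (m : ℕ) : eval y
    (W (X 0) (X 1) (X 2) (X 3) (X 4) (-(X 0 + X 1 + X 2 + X 3 + X 4)) (X 5 : MvPolynomial (Fin 6) ℚ) m) =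
    W (y 0) (y 1) (y 2) (y 3) (y 4) (-(y 0 + y 1 + y 2 + y 3 + y 4)) (y 5) m := by
  simp [W]

theorem u_two_explicit : u 2 = X 0 * X 0 + X 1 * X 1 + X 2 * X 2 + X 3 * X 3 + X 4 * X 4 + X 5 * X 5
    + X 0 * X 1 + X 0 * X 2 + X 0 * X 3 + X 0 * X 4 + X 1 * X 2 + X 1 * X 3 + X 1 * X 4
    + X 2 * X 3 + X 2 * X 4 + X 3 * X 4 := by
  have h2 : (C (1/12 : ℚ) : MvPolynomial (Fin 6) ℚ) * 12 = 1 := by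
    rw [show (12 : MvPolynomial (Fin 6) ℚ) = C 12 from rfl, ← C_mul]; norm_num
  rw [u_two, W_2 _ _ _ _ _ _ _ (by ring)]
  simp only [pS]
  linear_combination (X 0 * X 0 + X 1 * X 1 + X 2 * X 2 + X 3 * X 3 + X 4 * X 4 + X 5 * X 5
    + X 0 * X 1 + X 0 * X 2 + X 0 * X 3 + X 0 * X 4 + X 1 * X 2 + X 1 * X 3 + X 1 * X 4
    + X 2 * X 3 + X 2 * X 4 + X 3 * X 4) * h2

theorem coeff_XX (i j a b : Fin 6) :
    coeff (Finsupp.single i 1 + Finsupp.single j 1) (X a * X b : MvPolynomial (Fin 6) ℚ) =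
      if (a = i ∧ b = j) ∨ (a = j ∧ b = i) then 1 else 0 := by
  rw [X, X, monomial_mul, coeff_monomial]
  simp [Finsupp.single_add_single_eq_single_add_single]

/-- The explicit inverse of `GE6`. -/
def Hinv : Matrix (Fin 6) (Fin 6) ℚ :=
  !![5/3, -1/3, -1/3, -1/3, -1/3, 0;
     -1/3, 5/3, -1/3, -1/3, -1/3, 0;
     -1/3, -1/3, 5/3, -1/3, -1/3, 0;
     -1/3, -1/3, -1/3, 5/3, -1/3, 0;
     -1/3, -1/3, -1/3, -1/3, 5/3, 0;
     0, 0, 0, 0, 0, 1]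

theorem GE6_eq : GE6 =
  !![1, 1/2, 1/2, 1/2, 1/2, 0;
     1/2, 1, 1/2, 1/2, 1/2, 0;
     1/2, 1/2, 1, 1/2, 1/2, 0;
     1/2, 1/2, 1/2, 1, 1/2, 0;
     1/2, 1/2, 1/2, 1/2, 1, 0;
     0, 0, 0, 0, 0, 1] := by
  have hs (i : Fin 6) : (Finsupp.single i 2 : Fin 6 →₀ ℕ) = Finsupp.single i 1 + Finsupp.single i 1 := by
    rw [← Finsupp.single_add]
  ext i j
  unfold GE6
  rw [hs, u_two_explicit]
  simp only [coeff_add, coeff_XX]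
  fin_cases i <;> fin_cases j <;> simp

theorem GE6_inv : GE6⁻¹ = Hinv := by
  apply Matrix.inv_eq_right_inv
  rw [GE6_eq, Hinv]
  ext i j
  fin_cases i <;> fin_cases j <;> norm_num [Matrix.mul_apply, Fin.sum_univ_succ]

theorem pd_pS (i : Fin 6) (k : ℕ) (x0 x1 x2 x3 x4 s : MvPolynomial (Fin 6) ℚ) :
    pderiv i (pS x0 x1 x2 x3 x4 s k) = k * (x0 ^ (k-1) * pderiv i x0 + x1 ^ (k-1) * pderiv i x1
     + x2 ^ (k-1) * pderiv i x2 + x3 ^ (k-1) * pderiv i x3 + x4 ^ (k-1) * pderiv i x4 + s ^ (k-1) * pderiv i s) := by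
  simp only [pS, map_add, pderiv_pow]; ring

theorem pd_W8 (i : Fin 6) (x0 x1 x2 x3 x4 s t : MvPolynomial (Fin 6) ℚ) (h : x0 + x1 + x2 + x3 + x4 + s = 0) :
    pderiv i (W x0 x1 x2 x3 x4 s t 8) =
      gr x0 x1 x2 x3 x4 s t x0 * pderiv i x0 + gr x0 x1 x2 x3 x4 s t x1 * pderiv i x1 +
      gr x0 x1 x2 x3 x4 s t x2 * pderiv i x2 + gr x0 x1 x2 x3 x4 s t x3 * pderiv i x3 +
      gr x0 x1 x2 x3 x4 s t x4 * pderiv i x4 + gr x0 x1 x2 x3 x4 s t s * pderiv i s +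
      (112*t*pS x0 x1 x2 x3 x4 s 6 + 560*t^3*pS x0 x1 x2 x3 x4 s 4
        + 336*t^5*pS x0 x1 x2 x3 x4 s 2 + 96*t^7) * pderiv i t := by
  have hc (n : ℕ) [n.AtLeastTwo] : pderiv i (OfNat.ofNat n : MvPolynomial (Fin 6) ℚ) = 0 := by
    rw [show (OfNat.ofNat n : MvPolynomial (Fin 6) ℚ) = C (OfNat.ofNat n : ℚ) from (map_ofNat C n).symm, pderiv_C]
  rw [W_8 _ _ _ _ _ _ _ h]
  simp only [map_add, map_neg, pderiv_mul, pderiv_pow, pd_pS, hc, gr]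
  generalize pS x0 x1 x2 x3 x4 s 2 = q2
  generalize pS x0 x1 x2 x3 x4 s 3 = q3
  generalize pS x0 x1 x2 x3 x4 s 4 = q4
  generalize pS x0 x1 x2 x3 x4 s 5 = q5
  generalize pS x0 x1 x2 x3 x4 s 6 = q6
  push_cast
  ring

theorem pair_eq (a0 a1 a2 a3 a4 a5 : ℚ) : (∑ i : Fin 6, ∑ j : Fin 6,
    Hinv i j * ![a0, a1, a2, a3, a4, a5] i * ![a0, a1, a2, a3, a4, a5] j) =
    a5 ^ 2 + 2 * (a0 ^ 2 + a1 ^ 2 + a2 ^ 2 + a3 ^ 2 + a4 ^ 2 - (a0 + a1 + a2 + a3 + a4) ^ 2 / 6) := by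
  simp [Hinv, Fin.sum_univ_six]
  ring

/-- `⟨du₈, du₈⟩* = 896 u₁₂ u₂ + (160/9) u₉ u₅ + 112 u₈ u₆ - 8960 u₈ u₂³ -
(448/3) u₆² u₂ + 20160 u₆ u₂⁴ - (2576/3) u₅² u₂² - 130560 u₂⁷`. -/
theorem E6_pair_u8_u8 :
    pairE6 (u 8) (u 8) =
      C (896 : ℚ) * u 12 * u 2 + C (160/9 : ℚ) * u 9 * u 5 + C (112 : ℚ) * u 8 * u 6 -
        C (8960 : ℚ) * u 8 * u 2 ^ 3 - C (448/3 : ℚ) * u 6 ^ 2 * u 2 +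
        C (20160 : ℚ) * u 6 * u 2 ^ 4 - C (2576/3 : ℚ) * u 5 ^ 2 * u 2 ^ 2 -
        C (130560 : ℚ) * u 2 ^ 7 := by
  apply MvPolynomial.funext
  intro y
  have hy : y 0 + y 1 + y 2 + y 3 + y 4 + -(y 0 + y 1 + y 2 + y 3 + y 4) = 0 := by ring
  have key := final_id _ _ _ _ _ _ (y 5) hy
  have hd : (fun i => eval y (pderiv i (u 8))) =
    (let g := gr (y 0) (y 1) (y 2) (y 3) (y 4) (-(y 0 + y 1 + y 2 + y 3 + y 4)) (y 5)
     let p := pS (y 0) (y 1) (y 2) (y 3) (y 4) (-(y 0 + y 1 + y 2 + y 3 + y 4))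
     let s := -(y 0 + y 1 + y 2 + y 3 + y 4)
     ![g (y 0) - g s, g (y 1) - g s, g (y 2) - g s, g (y 3) - g s, g (y 4) - g s,
      112*(y 5)*p 6 + 560*(y 5)^3*p 4 + 336*(y 5)^5*p 2 + 96*(y 5)^7]) := by
    funext i
    rw [u_ne 8 (by norm_num), pd_W8 _ _ _ _ _ _ _ _ (by ring)]
    fin_cases i <;> simp [pderiv_X, Pi.single_apply, gr, pS, sub_eq_add_neg]
  have hL : eval y (pairE6 (u 8) (u 8)) = ∑ i : Fin 6, ∑ j : Fin 6,
      Hinv i j * (fun i => eval y (pderiv i (u 8))) i * (fun i => eval y (pderiv i (u 8))) j := by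
    simp only [pairE6, GE6_inv, map_sum, map_mul, eval_C]
  rw [hL, hd]
  dsimp only
  rw [pair_eq, u_two, u_ne 12 (by norm_num), u_ne 9 (by norm_num), u_ne 8 (by norm_num),
    u_ne 6 (by norm_num), u_ne 5 (by norm_num)]
  simp only [map_add, map_sub, map_mul, map_pow, eval_C, eval_W]
  rw [← key]
  generalize gr (R := ℚ) _ _ _ _ _ _ _ (y 0) = g0
  generalize gr (R := ℚ) _ _ _ _ _ _ _ (y 1) = g1
  generalize gr (R := ℚ) _ _ _ _ _ _ _ (y 2) = g2
  generalize gr (R := ℚ) _ _ _ _ _ _ _ (y 3) = g3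
  generalize gr (R := ℚ) _ _ _ _ _ _ _ (y 4) = g4
  generalize gr (R := ℚ) _ _ _ _ _ _ _ (-(y 0 + y 1 + y 2 + y 3 + y 4)) = g5
  ring
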